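/- If the leading coefficients are normalized by ∏_{j=1}^{n} c_{j0} = (det[μ_j^{ν−1}]_{j,ν=1,…,n})^{−1} (the μ_j being pairwise distinct, so this Vandermonde determinant is nonzero), then the Wronskian of the solutions C_j is identically one: det[C_j^{(ν−1)}(x)]_{j,ν=1,…,n} = 1 for all x > 0. -/

import Mathlib

open Filter Topology in
theorem aux_det_deriv {n : ℕ} (M : ℂ → Matrix (Fin n) (Fin n) ℂ) (M' : Matrix (Fin n) (Fin n) ℂ) (t : ℂ)
    (h : ∀ i j, HasDerivAt (fun s => M s i j) (M' i j) t) :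
    HasDerivAt (fun s => (M s).det) ((M t).adjugate * M').trace t := by
  have h1 : HasDerivAt (fun s => ∑ σ : Equiv.Perm (Fin n), ((Equiv.Perm.sign σ : ℤ) : ℂ) * ∏ i, M s (σ i) i)
      (∑ σ : Equiv.Perm (Fin n), ((Equiv.Perm.sign σ : ℤ) : ℂ) *
        ∑ i, (∏ l ∈ Finset.univ.erase i, M t (σ l) l) • M' (σ i) i) t := by
    refine HasDerivAt.fun_sum fun σ _ => HasDerivAt.const_mul _ ?_
    exact HasDerivAt.fun_finsetProd (fun i _ => h (σ i) i)
  have e : (fun s => (M s).det) = fun s => ∑ σ : Equiv.Perm (Fin n), ((Equiv.Perm.sign σ : ℤ) : ℂ) * ∏ i, M s (σ i) i := by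
    funext s; rw [Matrix.det_apply']
  rw [e]
  convert! h1 using 1
  have : ∀ i, ((M t).adjugate * M') i i = ((M t).updateCol i (fun j => M' j i)).det := by
    intro i
    rw [← Matrix.cramer_apply, Matrix.cramer_eq_adjugate_mulVec]
    rfl
  simp only [Matrix.trace, Matrix.diag_apply, this, Matrix.det_apply', Finset.mul_sum]
  rw [Finset.sum_comm]
  refine Finset.sum_congr rfl fun σ _ => Finset.sum_congr rfl fun i _ => ?_
  congr 1
  rw [← Finset.prod_erase_mul _ _ (Finset.mem_univ i), smul_eq_mul]
  congr 1
  · refine Finset.prod_congr rfl fun l hl => ?_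
    rw [Matrix.updateCol_ne (Finset.ne_of_mem_erase hl)]
  · simp

def AuxEnt (b : ℕ → ℂ) : Prop := ∀ r : ℝ, 0 ≤ r → Summable fun k => ‖b k‖ * r ^ k

noncomputable def auxP (b : ℕ → ℂ) (t : ℂ) : ℂ := ∑' k, b k * t ^ k

theorem AuxEnt.summable {b : ℕ → ℂ} (h : AuxEnt b) (t : ℂ) : Summable fun k => b k * t ^ k := by
  refine Summable.of_norm ?_
  simpa using h ‖t‖ (norm_nonneg _)

theorem AuxEnt.lin {b : ℕ → ℂ} (h : AuxEnt b) (α β : ℂ) : AuxEnt fun k => b k * (α + β * k) := by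
  intro r hr
  refine Summable.of_nonneg_of_le (fun k => by positivity) (fun k => ?_)
    ((h (2 * r) (by positivity)).mul_left (‖α‖ + ‖β‖))
  have h2 : (k : ℝ) ≤ 2 ^ k := by exact_mod_cast (Nat.lt_two_pow_self (n := k)).le
  have h1 : (1 : ℝ) ≤ 2 ^ k := one_le_pow₀ (by norm_num)
  have : ‖α + β * k‖ ≤ (‖α‖ + ‖β‖) * 2 ^ k := by
    refine (norm_add_le _ _).trans ?_
    rw [norm_mul, Complex.norm_natCast]
    nlinarith [norm_nonneg α, norm_nonneg β]
  calc ‖b k * (α + β * k)‖ * r ^ k = (‖b k‖ * r ^ k) * ‖α + β * k‖ := by rw [norm_mul]; ring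
    _ ≤ (‖b k‖ * r ^ k) * ((‖α‖ + ‖β‖) * 2 ^ k) := by gcongr
    _ = _ := by rw [mul_pow]; ring

theorem AuxEnt.hasDerivAt {b : ℕ → ℂ} (h : AuxEnt b) (t : ℂ) :
    ∃ d, HasDerivAt (auxP b) d t ∧ t * d = auxP (fun k => b k * k) t := by
  refine ⟨∑' k, b k * (k * t ^ (k - 1)), ?_, ?_⟩
  · have hR : 1 ≤ ‖t‖ + 1 := by linarith [norm_nonneg t]
    have hs := (h.lin 0 1) (‖t‖ + 1) (by linarith)
    refine hasDerivAt_tsum_of_isPreconnected (g := fun k z => b k * z ^ k)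
      (g' := fun k z => b k * (k * z ^ (k - 1))) (t := Metric.ball 0 (‖t‖ + 1)) (y₀ := t) hs Metric.isOpen_ball
      (convex_ball _ _).isPreconnected ?_ ?_ (by simp) (h.summable t) (by simp)
    · intro k y _
      exact (hasDerivAt_pow k y).const_mul _
    · intro k y hy
      have hy : ‖y‖ < ‖t‖ + 1 := by simpa using hy
      simp only [norm_mul, zero_add, one_mul, norm_pow]
      rw [mul_assoc]
      gcongr
      calc ‖y‖ ^ (k - 1) ≤ (‖t‖ + 1) ^ (k - 1) := by gcongr
        _ ≤ (‖t‖ + 1) ^ k := pow_le_pow_right₀ hR (by omega)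
  · rw [← tsum_mul_left, auxP]
    refine tsum_congr fun k => ?_
    cases k with
    | zero => simp
    | succ k => simp [pow_succ]; ring

/-- The basic monic polynomials. -/
noncomputable def auxQ (i : ℕ) : Polynomial ℂ :=
  ∏ k ∈ Finset.range i, (Polynomial.X - Polynomial.C (k : ℂ))

theorem auxQ_monic (i : ℕ) : (auxQ i).Monic :=
  Polynomial.monic_prod_of_monic _ _ fun k _ => Polynomial.monic_X_sub_C _

theorem auxQ_natDegree (i : ℕ) : (auxQ i).natDegree = i := by
  rw [auxQ, Polynomial.natDegree_prod_of_monic _ _ fun k _ => Polynomial.monic_X_sub_C _]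
  simp only [Polynomial.natDegree_X_sub_C]
  simp

theorem auxQ_eval (i : ℕ) (z : ℂ) : (auxQ i).eval z = ∏ k ∈ Finset.range i, (z - (k : ℂ)) := by
  simp [auxQ, Polynomial.eval_prod]

theorem aux_sum (n : ℕ) (hn : 2 ≤ n) (v : ℕ → ℂ) (hvn : v n = 1) (hvn1 : v (n - 1) = 0)
    (μ : Fin n → ℂ)
    (h : ∀ z, ∑ j ∈ Finset.range (n + 1), v j * ∏ k ∈ Finset.range j, (z - (k : ℂ)) = ∏ j, (z - μ j)) :
    ∑ j, μ j = ∑ i : Fin n, ((i : ℕ) : ℂ) := by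
  have hp : ∑ j ∈ Finset.range (n + 1), Polynomial.C (v j) * auxQ j
      = ∏ j, (Polynomial.X - Polynomial.C (μ j)) := by
    refine Polynomial.funext fun z => ?_
    simpa [Polynomial.eval_finsetSum, Polynomial.eval_prod, auxQ_eval] using h z
  have h2 := congrArg (fun p => Polynomial.coeff p (n - 1)) hp
  have h3 := Polynomial.prod_X_sub_C_coeff_card_pred (Finset.univ : Finset (Fin n)) μ (by simp; omega)
  have h4 : (auxQ n).coeff ((Finset.range n).card - 1) = _ := Polynomial.prod_X_sub_C_coeff_card_pred (Finset.range n) (fun k => (k : ℂ)) (by simp; omega)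
  rw [Finset.card_univ, Fintype.card_fin] at h3
  rw [Finset.card_range] at h4
  obtain ⟨m, rfl⟩ : ∃ m, n = m + 2 := ⟨n - 2, by omega⟩
  simp only [h3, Polynomial.finsetSum_coeff, Polynomial.coeff_C_mul] at h2
  rw [Finset.sum_range_succ, Finset.sum_range_succ, hvn, h4, Finset.sum_eq_zero] at h2
  · have hvn1 : v (m + 1) = 0 := hvn1
    rw [hvn1] at h2
    rw [Fin.sum_univ_eq_sum_range (fun k => (k : ℂ))]
    simpa using h2.symm
  · intro i hi
    rw [Polynomial.coeff_eq_zero_of_natDegree_lt, mul_zero]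
    rw [auxQ_natDegree]; simpa using hi

theorem aux_ent (n : ℕ) (hn : 2 ≤ n) (μ : Fin n → ℂ) (a : ℂ) (c : ℕ → ℂ) 
    (hc : ∀ k : ℕ, c (k + 1) * ∏ i, (a + ((k + 1 : ℕ) : ℂ) * n - μ i) = c k) : AuxEnt c := by
  intro r hr
  let p : Polynomial ℂ := ∏ j, (Polynomial.X - Polynomial.C (μ j))
  have hd : 0 < p.degree := by
    rw [← Polynomial.natDegree_pos_iff_degree_pos,
      Polynomial.natDegree_prod_of_monic _ _ fun k _ => Polynomial.monic_X_sub_C _]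
    simp; omega
  have hz : Filter.Tendsto (fun k : ℕ => ‖a + ((k + 1 : ℕ) : ℂ) * n‖) Filter.atTop Filter.atTop := by
    have h1 : Filter.Tendsto (fun k : ℕ => (k : ℝ) - ‖a‖) Filter.atTop Filter.atTop :=
      Filter.tendsto_atTop_add_const_right _ _ tendsto_natCast_atTop_atTop
    refine Filter.tendsto_atTop_mono (fun k => ?_) h1
    have h2 : ‖((k + 1 : ℕ) : ℂ) * n‖ = (k + 1) * n := by
      rw [norm_mul, Complex.norm_natCast, Complex.norm_natCast]; push_cast; ring
    have h3 := norm_sub_le (a + ((k + 1 : ℕ) : ℂ) * n) a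
    rw [add_sub_cancel_left, h2] at h3
    have : (2 : ℝ) ≤ n := by exact_mod_cast hn
    nlinarith [(Nat.cast_nonneg k : (0 : ℝ) ≤ k)]
  have ht := p.tendsto_norm_atTop hd hz
  refine summable_of_ratio_norm_eventually_le (r := 1 / 2) (by norm_num) ?_
  filter_upwards [ht.eventually_ge_atTop (2 * r)] with k hk
  have : p.eval (a + ((k + 1 : ℕ) : ℂ) * n) = ∏ i, (a + ((k + 1 : ℕ) : ℂ) * n - μ i) := by
    simp [p, Polynomial.eval_prod]
  rw [this] at hk
  rw [← hc k]
  simp only [norm_mul, norm_norm, norm_pow, Real.norm_of_nonneg hr, pow_succ]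
  have : 0 ≤ ‖c (k+1)‖ * r ^ k := by positivity
  nlinarith

theorem aux_iter (n : ℕ) (a : ℂ) (F : ℕ → ℂ → ℂ) (F' : ℕ → ℂ → ℂ)
    (hF : ∀ i t, HasDerivAt (F i) (F' i t) t)
    (hF' : ∀ i t, n * (t * F' i t) + (a - i) * F i t = F (i + 1) t)
    (C : ℝ → ℂ) (hC : ∀ x : ℝ, C x = (x : ℂ) ^ a * F 0 ((x : ℂ) ^ n)) (i : ℕ) :
    ∀ x : ℝ, 0 < x → iteratedDeriv i C x = (x : ℂ) ^ (a - i) * F i ((x : ℂ) ^ n) := by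
  induction i with
  | zero => intro x _; simp [hC]
  | succ i ih =>
    intro x hx
    have hx0 : (x : ℂ) ≠ 0 := by exact_mod_cast hx.ne'
    rw [iteratedDeriv_succ]
    have he : iteratedDeriv i C =ᶠ[nhds x] fun x : ℝ => (x : ℂ) ^ (a - i) * F i ((x : ℂ) ^ n) := by
      filter_upwards [lt_mem_nhds hx] with y hy using ih y hy
    rw [he.deriv_eq]
    have h1 : HasDerivAt (fun z : ℂ => z ^ (a - i)) ((a - i) * (x : ℂ) ^ (a - i - 1)) (x : ℂ) := by
      simpa using (hasDerivAt_id (x : ℂ)).cpow_const (c := a - i) (Or.inl (by simpa using hx))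
    have h2 : HasDerivAt (fun z : ℂ => F i (z ^ n)) (F' i ((x : ℂ) ^ n) * (n * (x : ℂ) ^ (n - 1))) (x : ℂ) :=
      (hF i ((x : ℂ) ^ n)).comp (x : ℂ) (hasDerivAt_pow n (x : ℂ))
    have h3 := (h1.mul h2).comp_ofReal
    refine h3.deriv.trans ?_
    rw [← hF' i, Complex.cpow_sub (a - i) 1 hx0]
    rw [show a - ((i + 1 : ℕ) : ℂ) = a - i - 1 by push_cast; ring, Complex.cpow_sub (a - i) 1 hx0, Complex.cpow_one]
    rcases n with _ | n
    · simp; ring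
    · simp only [Nat.add_sub_cancel]
      field_simp
      ring

theorem stmt3 (n : ℕ) (hn : 2 ≤ n) (v : ℕ → ℂ) (hvn : v n = 1) (hvn1 : v (n - 1) = 0)
    (Δ : ℂ → ℂ)
    (hΔ : ∀ z, Δ z = ∑ j ∈ Finset.range (n + 1), v j * ∏ k ∈ Finset.range j, (z - (k : ℂ)))
    (μ : Fin n → ℂ)
    (hroots : ∀ z, Δ z = ∏ j, (z - μ j))
    (hsep : ∀ j k, j ≠ k → ∀ s : ℤ, μ j - μ k ≠ (s : ℂ) * (n : ℂ))
    (hre : StrictMono fun j => (μ j).re)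
    (c0 : Fin n → ℂ) (hc0 : ∀ j, c0 j ≠ 0)
    (hnorm : ∏ j, c0 j = (Matrix.det (Matrix.of fun j i : Fin n => μ j ^ (i : ℕ)))⁻¹)
    (c : Fin n → ℕ → ℂ)
    (hc : ∀ j k, c j k = c0 j * (∏ s ∈ Finset.Icc 1 k, Δ (μ j + (s : ℂ) * (n : ℂ)))⁻¹)
    (C : Fin n → ℝ → ℂ)
    (hC : ∀ j x, C j x = (x : ℂ) ^ (μ j) * ∑' k : ℕ, c j k * (x : ℂ) ^ (n * k)) :
    ∀ x : ℝ, 0 < x →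
      Matrix.det (Matrix.of fun j i : Fin n => iteratedDeriv (i : ℕ) (C j) x) = 1 := by
  have hn0 : n ≠ 0 := by omega
  have hnC : (n : ℂ) ≠ 0 := by exact_mod_cast hn0
  -- nonvanishing
  have hne : ∀ j (s : ℕ), s ≠ 0 → Δ (μ j + (s : ℂ) * n) ≠ 0 := by
    intro j s hs
    rw [hroots, Finset.prod_ne_zero_iff]
    intro i _ h0
    by_cases hij : i = j
    · subst hij
      have : (s : ℂ) * n = 0 := by linear_combination h0
      rcases mul_eq_zero.1 this with h | h
      · exact hs (by exact_mod_cast h)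
      · exact hnC h
    · apply hsep i j hij (s : ℤ)
      push_cast
      linear_combination -h0
  have hrec : ∀ j (k : ℕ), c j (k + 1) * Δ (μ j + ((k + 1 : ℕ) : ℂ) * n) = c j k := by
    intro j k
    rw [hc, hc, Finset.prod_Icc_succ_top (by omega), mul_inv, mul_assoc, mul_assoc,
      inv_mul_cancel₀ (hne j (k + 1) (by omega)), mul_one]
  have hc00 : ∀ j, c j 0 = c0 j := by intro j; simp [hc]
  have hent : ∀ j, AuxEnt (c j) := fun j =>
    aux_ent n hn μ (μ j) (c j) (fun k => by rw [← hroots]; exact hrec j k)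
  let b : Fin n → ℕ → ℕ → ℂ := fun j i k => c j k * (auxQ i).eval (μ j + n * k)
  have hbs : ∀ j i k, b j (i + 1) k = b j i k * ((μ j - i) + n * k) := by
    intro j i k
    simp only [b, auxQ_eval, Finset.prod_range_succ]
    ring
  have hbent : ∀ j i, AuxEnt (b j i) := by
    intro j i
    induction i with
    | zero => simpa [b, auxQ] using hent j
    | succ i ih =>
      have : b j (i + 1) = fun k => b j i k * ((μ j - i) + n * k) := funext (hbs j i)
      rw [this]
      exact ih.lin _ _
  let F : Fin n → ℕ → ℂ → ℂ := fun j i => auxP (b j i)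
  choose F' hF' hF'2 using fun j i t => (hbent j i).hasDerivAt t
  have hstep : ∀ j i t, n * (t * F' j i t) + (μ j - i) * F j i t = F j (i + 1) t := by
    intro j i t
    rw [hF'2]
    have s1 : Summable fun k : ℕ => b j i k * k * t ^ k := by
      simpa using ((hbent j i).lin 0 1).summable t
    simp only [F, auxP]
    rw [← tsum_mul_left, ← tsum_mul_left,
      ← (s1.mul_left _).tsum_add (((hbent j i).summable t).mul_left _)]
    refine tsum_congr fun k => ?_
    rw [hbs]; ring
  have hode : ∀ j t, ∑ i ∈ Finset.range (n + 1), v i * F j i t = t * F j 0 t := by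
    intro j t
    have e1 : ∑ i ∈ Finset.range (n + 1), v i * F j i t
        = ∑' k : ℕ, c j k * Δ (μ j + n * k) * t ^ k := by
      simp only [F, auxP, ← tsum_mul_left]
      rw [← Summable.tsum_finsetSum (fun i _ => ((hbent j i).summable t).mul_left _)]
      refine tsum_congr fun k => ?_
      rw [hΔ, Finset.mul_sum, Finset.sum_mul]
      refine Finset.sum_congr rfl fun i _ => ?_
      simp only [b, auxQ_eval]; ring
    have e2 : ∀ k : ℕ, c j (k + 1) * Δ (μ j + n * ((k + 1 : ℕ) : ℂ)) * t ^ (k + 1) = t * (b j 0 k * t ^ k) := by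
      intro k
      rw [mul_comm (n : ℂ), hrec]
      simp [b, auxQ]; ring
    have s2 : Summable fun k : ℕ => c j k * Δ (μ j + n * k) * t ^ k := by
      rw [← summable_nat_add_iff 1]
      simp only [e2]
      exact ((hbent j 0).summable t).mul_left _
    have e3 : Δ (μ j) = 0 := by
      rw [hroots]; exact Finset.prod_eq_zero (Finset.mem_univ j) (sub_self _)
    rw [e1, s2.tsum_eq_zero_add]
    simp only [e2, tsum_mul_left]
    simp [e3, F, auxP]
  have hiter : ∀ j (i : ℕ) (x : ℝ), 0 < x →
      iteratedDeriv i (C j) x = (x : ℂ) ^ (μ j - i) * F j i ((x : ℂ) ^ n) := by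
    intro j i
    refine aux_iter n (μ j) (F j) (F' j) (hF' j) (hstep j) (C j) (fun x => ?_) i
    rw [hC]
    simp [F, auxP, b, auxQ, pow_mul]
  have hsum := aux_sum n hn v hvn hvn1 μ (fun z => by rw [← hΔ, hroots])
  let M : ℂ → Matrix (Fin n) (Fin n) ℂ := fun t => Matrix.of fun j i => F j i t
  let M' : ℂ → Matrix (Fin n) (Fin n) ℂ := fun t => Matrix.of fun j i => F' j i t
  have hM : ∀ t, HasDerivAt (fun s => (M s).det) ((M t).adjugate * M' t).trace t :=
    fun t => aux_det_deriv M (M' t) t (fun j i => hF' j i t)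
  have hzero : ∀ t, t * ((M t).adjugate * M' t).trace = 0 := by
    intro t
    let B : Matrix (Fin n) (Fin n) ℂ := Matrix.of fun l i =>
      if (i : ℕ) + 1 = n then (if (l : ℕ) = 0 then t else 0) - v l else if (l : ℕ) = i + 1 then 1 else 0
    have hB : B.trace = 0 := by
      refine Finset.sum_eq_zero fun i _ => ?_
      simp only [B, Matrix.diag_apply, Matrix.of_apply]
      split_ifs with h1 h2 h3
      · omega
      · rw [show (i : ℕ) = n - 1 by omega, hvn1]; simp
      · omega
      · rfl
    have hMB : ∀ j (i : Fin n), (M t * B) j i = F j (i + 1) t := by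
      intro j i
      rw [Matrix.mul_apply]
      simp only [M, B, Matrix.of_apply]
      split_ifs with h1
      · rw [h1]
        have := hode j t
        rw [Finset.sum_range_succ, hvn, ← Fin.sum_univ_eq_sum_range (fun l => v l * F j l t)] at this
        simp only [mul_sub, Finset.sum_sub_distrib]
        have h0 : ∑ x : Fin n, F j x t * (if (x : ℕ) = 0 then t else 0) = t * F j 0 t := by
          rw [Finset.sum_eq_single (⟨0, by omega⟩ : Fin n)]
          · simp [mul_comm]
          · intro l _ hl
            rw [if_neg, mul_zero]
            intro h; exact hl (Fin.ext h)
          · simp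
        rw [h0, ← this]
        simp only [mul_comm (v _)]
        ring
      · have hi := i.2
        rw [Finset.sum_eq_single (⟨i + 1, by omega⟩ : Fin n)]
        · simp
        · intro l _ hl
          rw [if_neg, mul_zero]
          intro h; exact hl (Fin.ext h)
        · simp
    have hEq : ((n : ℂ) * t) • M' t = M t * (B + Matrix.diagonal fun i : Fin n => ((i : ℕ) : ℂ))
        - Matrix.diagonal μ * M t := by
      ext j i
      rw [Matrix.mul_add, Matrix.sub_apply, Matrix.add_apply, hMB, Matrix.mul_diagonal,
        Matrix.diagonal_mul, Matrix.smul_apply, ← hstep]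
      simp only [M, M', Matrix.of_apply, smul_eq_mul]
      ring
    have hT : (n : ℂ) * (t * ((M t).adjugate * M' t).trace) = 0 := by
      rw [← mul_assoc, ← smul_eq_mul, ← Matrix.trace_smul, ← Matrix.mul_smul, hEq, Matrix.mul_sub,
        Matrix.trace_sub, ← Matrix.mul_assoc, Matrix.adjugate_mul, ← Matrix.mul_assoc,
        Matrix.trace_mul_comm _ (M t), ← Matrix.mul_assoc, Matrix.mul_adjugate]
      simp only [Matrix.smul_mul, Matrix.one_mul, Matrix.trace_smul, Matrix.trace_add, hB,
        Matrix.trace_diagonal, hsum]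
      simp
    exact (mul_eq_zero.1 hT).resolve_left hnC
  have hdiff : Differentiable ℂ fun s => (M s).det := fun t => (hM t).differentiableAt
  have hder : ∀ t, deriv (fun s => (M s).det) t = 0 := by
    have hcont : Continuous (deriv fun s => (M s).det) := (hdiff.contDiff (n := 1)).continuous_deriv le_rfl
    have := hcont.ext_on (dense_compl_singleton (0 : ℂ)) continuous_const
      (g := fun _ => (0 : ℂ)) (fun t ht => by
        change deriv (fun s => (M s).det) t = 0
        rw [(hM t).deriv]
        exact (mul_eq_zero.1 (hzero t)).resolve_left ht)
    exact fun t => congrFun this t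
  have hM0 : (M 0).det = 1 := by
    have e : M 0 = Matrix.of fun j i : Fin n => c0 j * (Matrix.of fun j i : Fin n => (auxQ i).eval (μ j)) j i := by
      ext j i
      simp only [M, F, auxP, Matrix.of_apply]
      rw [tsum_eq_single 0 (fun k hk => by simp [hk])]
      simp [b, hc00]
    have hv := Matrix.det_eval_matrixOfPolynomials_eq_det_vandermonde μ (fun i : Fin n => auxQ i)
      (fun i => auxQ_natDegree i) (fun i => auxQ_monic i)
    have hv2 : Matrix.vandermonde μ = Matrix.of fun j i : Fin n => μ j ^ (i : ℕ) := by
      ext; simp [Matrix.vandermonde_apply]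
    rw [e, Matrix.det_mul_column, ← hv, hnorm, hv2]
    refine inv_mul_cancel₀ ?_
    rw [← hv2, Matrix.det_vandermonde_ne_zero_iff]
    intro i j hij
    exact hre.injective (by simp [hij])
  intro x hx
  have hx0 : (x : ℂ) ≠ 0 := by exact_mod_cast hx.ne'
  have e : (Matrix.of fun j i : Fin n => iteratedDeriv (i : ℕ) (C j) x)
      = Matrix.diagonal (fun j => (x : ℂ) ^ (μ j)) * M ((x : ℂ) ^ n)
        * Matrix.diagonal (fun i : Fin n => (x : ℂ) ^ (-((i : ℕ) : ℂ))) := by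
    ext j i
    rw [Matrix.mul_diagonal, Matrix.diagonal_mul, Matrix.of_apply, hiter j i x hx, sub_eq_add_neg,
      Complex.cpow_add _ _ hx0]
    simp only [M, Matrix.of_apply]
    ring
  have hprod : ∀ f : Fin n → ℂ, ∏ j, (x : ℂ) ^ (f j) = (x : ℂ) ^ (∑ j, f j) := by
    intro f
    simp only [Complex.cpow_def_of_ne_zero hx0, ← Complex.exp_sum, Finset.mul_sum]
  rw [e, Matrix.det_mul, Matrix.det_mul, Matrix.det_diagonal, Matrix.det_diagonal, hprod, hprod,
    is_const_of_deriv_eq_zero hdiff hder _ 0, hM0, mul_one, ← Complex.cpow_add _ _ hx0,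
    Finset.sum_neg_distrib, hsum, add_neg_cancel, Complex.cpow_zero]
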